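/- arXiv:math/0603182 — 3 statements merged into one kernel-verified Lean document; each statement's English description precedes it below -/
import Mathlib

section
/- For every x ∈ X⁷ there exist g₁, g₂ ∈ SU(2)ₑ and t ∈ ℝ such that x = g₁·R(t)·g₂. -/
open Matrix

/-- `SU(3)`: the group of 3×3 complex unitary matrices of determinant 1. -/
abbrev SU3 : Type := Matrix.specialUnitaryGroup (Fin 3) ℂ

/-- `X⁷ = {g ∈ SU(3) : Im g₁₁ = 0}`. -/
def X7 : Set SU3 := {g | ((g : Matrix (Fin 3) (Fin 3) ℂ) 0 0).im = 0}

/-- `SU(2)ₑ`: the subgroup of `SU(3)` stabilizing the first basis vector, i.e. those `g` with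
`g₁₁ = 1` and `g₁ⱼ = gⱼ₁ = 0` for `j ∈ {2,3}`. -/
def SU2e : Set SU3 :=
  {g | (g : Matrix (Fin 3) (Fin 3) ℂ) 0 0 = 1 ∧
    ∀ j : Fin 3, j ≠ 0 →
      (g : Matrix (Fin 3) (Fin 3) ℂ) 0 j = 0 ∧ (g : Matrix (Fin 3) (Fin 3) ℂ) j 0 = 0}

/-- The real rotation matrix `R(t)` with rows `(cos t, −sin t, 0)`, `(sin t, cos t, 0)`,
`(0,0,1)`, viewed as a complex matrix. -/
noncomputable def Rmat (t : ℝ) : Matrix (Fin 3) (Fin 3) ℂ :=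
  !![(Real.cos t : ℂ), -(Real.sin t : ℂ), 0;
     (Real.sin t : ℂ), (Real.cos t : ℂ), 0;
     0, 0, 1]

open ComplexConjugate

/-- A matrix in `SU(3)` has rows of norm one; this is the first row. -/
lemma SU3.normSq_row_zero (y : SU3) :
    Complex.normSq (y.1 0 0) + Complex.normSq (y.1 0 1) + Complex.normSq (y.1 0 2) = 1 := by
  have h := congrFun (congrFun
    (mem_unitaryGroup_iff.1 (mem_specialUnitaryGroup_iff.1 y.2).1) 0) 0
  simp only [star_eq_conjTranspose, mul_apply, conjTranspose_apply, Fin.sum_univ_three,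
    RCLike.star_def, Complex.mul_conj, one_apply_eq] at h
  exact_mod_cast h

/-- A matrix in `SU(3)` has columns of norm one; this is the first column. -/
lemma SU3.normSq_col_zero (y : SU3) :
    Complex.normSq (y.1 0 0) + Complex.normSq (y.1 1 0) + Complex.normSq (y.1 2 0) = 1 := by
  have h := SU3.normSq_row_zero (star y)
  simpa [star_apply] using h

/-- An element of `SU(3)` fixing the first basis vector lies in `SU(2)ₑ`. -/
lemma mem_SU2e_of_col_zero (y : SU3) (h0 : y.1 0 0 = 1) (h1 : y.1 1 0 = 0)
    (h2 : y.1 2 0 = 0) : y ∈ SU2e := by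
  have h := SU3.normSq_row_zero y
  rw [h0, map_one] at h
  have n1 := Complex.normSq_nonneg (y.1 0 1)
  have n2 := Complex.normSq_nonneg (y.1 0 2)
  have e1 : y.1 0 1 = 0 := Complex.normSq_eq_zero.1 (by linarith)
  have e2 : y.1 0 2 = 0 := Complex.normSq_eq_zero.1 (by linarith)
  refine ⟨h0, fun j hj => ?_⟩
  fin_cases j
  · exact absurd rfl hj
  · exact ⟨e1, h1⟩
  · exact ⟨e2, h2⟩

lemma Rmat_mem (t : ℝ) : Rmat t ∈ specialUnitaryGroup (Fin 3) ℂ := by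
  have h : (Real.cos t : ℂ) ^ 2 + (Real.sin t : ℂ) ^ 2 = 1 := by
    exact_mod_cast Real.cos_sq_add_sin_sq t
  refine mem_specialUnitaryGroup_iff.2 ⟨mem_unitaryGroup_iff.2 ?_, ?_⟩
  · ext i j
    fin_cases i <;> fin_cases j <;>
      simp [Rmat, star_eq_conjTranspose, mul_apply, Fin.sum_univ_three, -Complex.ofReal_cos, -Complex.ofReal_sin] <;>
      first | ring1 | linear_combination h
  · rw [det_fin_three]
    simp [Rmat, -Complex.ofReal_cos, -Complex.ofReal_sin]
    linear_combination h

/-- The block matrix `diag(1, A)` with `A ∈ SU(2)` having first column `(u, v)`. -/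
def blockSU2 (u v : ℂ) : Matrix (Fin 3) (Fin 3) ℂ :=
  !![1, 0, 0; 0, u, -conj v; 0, v, conj u]

lemma blockSU2_mem {u v : ℂ} (h : Complex.normSq u + Complex.normSq v = 1) :
    blockSU2 u v ∈ specialUnitaryGroup (Fin 3) ℂ := by
  have hc : u * conj u + v * conj v = 1 := by
    rw [Complex.mul_conj, Complex.mul_conj]
    exact_mod_cast h
  refine mem_specialUnitaryGroup_iff.2 ⟨mem_unitaryGroup_iff.2 ?_, ?_⟩
  · ext i j
    fin_cases i <;> fin_cases j <;>
      simp [blockSU2, star_eq_conjTranspose, mul_apply, Fin.sum_univ_three] <;>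
      first | ring1 | linear_combination hc
  · rw [det_fin_three]
    simp [blockSU2]
    linear_combination hc

/-- Every vector of `ℂ²` of norm `s` is `s` times a unit vector. -/
lemma exists_unit_mul_eq {b c : ℂ} {s : ℝ}
    (h : Complex.normSq b + Complex.normSq c = s ^ 2) :
    ∃ u v : ℂ, Complex.normSq u + Complex.normSq v = 1 ∧ u * s = b ∧ v * s = c := by
  rcases eq_or_ne s 0 with rfl | hs
  · have n1 := Complex.normSq_nonneg b
    have n2 := Complex.normSq_nonneg c
    have hb : b = 0 := Complex.normSq_eq_zero.1 (by linarith)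
    have hc : c = 0 := Complex.normSq_eq_zero.1 (by linarith)
    exact ⟨1, 0, by simp, by simp [hb], by simp [hc]⟩
  · have hsc : (s : ℂ) ≠ 0 := by exact_mod_cast hs
    refine ⟨b / s, c / s, ?_, div_mul_cancel₀ _ hsc, div_mul_cancel₀ _ hsc⟩
    rw [map_div₀, map_div₀, Complex.normSq_ofReal, ← add_div, h, sq]
    exact div_self (mul_ne_zero hs hs)

/-- Every `x ∈ X⁷` can be written as `x = g₁ · R(t) · g₂` with
`g₁, g₂ ∈ SU(2)ₑ` and `t ∈ ℝ`. -/
theorem X7_decomposition (x : SU3) (hx : x ∈ X7) :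
    ∃ (g₁ g₂ : SU3) (t : ℝ), g₁ ∈ SU2e ∧ g₂ ∈ SU2e ∧
      (x : Matrix (Fin 3) (Fin 3) ℂ)
        = (g₁ : Matrix (Fin 3) (Fin 3) ℂ) * Rmat t * (g₂ : Matrix (Fin 3) (Fin 3) ℂ) := by
  have hx0 : (x.1 0 0).im = 0 := hx
  obtain ⟨a, ha⟩ : ∃ a : ℝ, x.1 0 0 = a := ⟨(x.1 0 0).re, Complex.ext rfl (by simpa using hx0)⟩
  have hcol := SU3.normSq_col_zero x
  rw [ha, Complex.normSq_ofReal] at hcol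
  have n1 := Complex.normSq_nonneg (x.1 1 0)
  have n2 := Complex.normSq_nonneg (x.1 2 0)
  have hcos : Real.cos (Real.arccos a) = a :=
    Real.cos_arccos (by nlinarith) (by nlinarith)
  set t := Real.arccos a
  have hsin : Complex.normSq (x.1 1 0) + Complex.normSq (x.1 2 0) = Real.sin t ^ 2 := by
    rw [Real.sin_sq, hcos]
    linarith
  obtain ⟨u, v, huv, hu, hv⟩ := exists_unit_mul_eq hsin
  let g : SU3 := ⟨blockSU2 u v, blockSU2_mem huv⟩
  let r : SU3 := ⟨Rmat t, Rmat_mem t⟩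
  have hgr : (g * r).1 *ᵥ Pi.single 0 1 = x.1 *ᵥ Pi.single 0 1 := by
    rw [mulVec_single_one, mulVec_single_one]
    ext i
    change (blockSU2 u v * Rmat t) i 0 = x.1 i 0
    fin_cases i <;>
      simp [blockSU2, Rmat, mul_apply, Fin.sum_univ_three, ha, hcos, hu, hv,
        -Complex.ofReal_cos, -Complex.ofReal_sin]
  have hy : ((g * r)⁻¹ * x).1 *ᵥ Pi.single 0 1 = Pi.single 0 1 := by
    change ((g * r)⁻¹.1 * x.1) *ᵥ Pi.single 0 1 = Pi.single 0 1
    rw [← mulVec_mulVec, ← hgr, mulVec_mulVec]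
    change ((g * r)⁻¹ * (g * r)).1 *ᵥ Pi.single 0 1 = Pi.single 0 1
    rw [inv_mul_cancel]
    exact one_mulVec _
  rw [mulVec_single_one] at hy
  refine ⟨g, (g * r)⁻¹ * x, t, ?_, ?_, ?_⟩
  · exact mem_SU2e_of_col_zero g rfl rfl rfl
  · exact mem_SU2e_of_col_zero _ (congrFun hy 0) (by simpa using congrFun hy 1)
      (by simpa using congrFun hy 2)
  · exact congrArg Subtype.val (mul_inv_cancel_left (g * r) x).symm
end

section
/- The subspace X⁷ of SU(3) (with the topology induced from the space of 3×3 complex matrices) is homeomorphic to S³ × S⁴, the product of the unit sphere in Euclidean ℝ⁴ and the unit sphere in Euclidean ℝ⁵. -/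
open Matrix

open ComplexConjugate

/-- A matrix with first column `(t, z, w)`, in `SU(3)` when this is a unit vector: the complex
reflection taking `(i, 0, 0)` to `(t, z, w)`, with its first and third columns rescaled. -/
noncomputable def frameMatrix (t : ℝ) (z w : ℂ) : Matrix (Fin 3) (Fin 3) ℂ :=
  !![(t : ℂ), -Complex.I * (t - Complex.I) * conj z / (t + Complex.I), -conj w;
     z, 1 - Complex.I * z * conj z / (t + Complex.I), -(z * conj w) / (t - Complex.I);
     w, -Complex.I * w * conj z / (t + Complex.I),
      (-Complex.I * (t + Complex.I) - w * conj w) / (t - Complex.I)]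

/-- The standard embedding of `SU(2)` in `SU(3)` as the stabilizer of the first basis vector. -/
def stabilizerMatrix (a b : ℂ) : Matrix (Fin 3) (Fin 3) ℂ :=
  !![1, 0, 0; 0, a, -conj b; 0, b, conj a]

lemma ofReal_add_I_ne_zero (t : ℝ) : (t : ℂ) + Complex.I ≠ 0 := fun h => by
  simpa using congrArg Complex.im h

lemma ofReal_sub_I_ne_zero (t : ℝ) : (t : ℂ) - Complex.I ≠ 0 := fun h => by
  simpa using congrArg Complex.im h

lemma frameMatrix_mem {t : ℝ} {z w : ℂ} (h : (t : ℂ) ^ 2 + z * conj z + w * conj w = 1) :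
    frameMatrix t z w ∈ specialUnitaryGroup (Fin 3) ℂ := by
  have hp := ofReal_add_I_ne_zero t
  have hq := ofReal_sub_I_ne_zero t
  have hq' : (t : ℂ) + -Complex.I ≠ 0 := by rwa [← sub_eq_add_neg]
  have hI := Complex.I_sq
  rw [mem_specialUnitaryGroup_iff]
  constructor
  · rw [mem_unitaryGroup_iff']
    ext i j
    fin_cases i <;> fin_cases j <;>
      simp [frameMatrix, star_eq_conjTranspose, mul_apply, Fin.sum_univ_three, one_apply] <;>
      generalize conj z = z' at * <;> generalize conj w = w' at * <;>
      generalize (t : ℂ) = s at * <;> generalize Complex.I = I at * <;>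
      field_simp <;> grind
  · rw [det_fin_three]
    simp only [frameMatrix, of_apply, cons_val', cons_val_zero, cons_val_one, cons_val]
    generalize conj z = z' at *
    generalize conj w = w' at *
    generalize (t : ℂ) = s at *
    generalize Complex.I = I at *
    field_simp
    grind

lemma stabilizerMatrix_mem {a b : ℂ} (h : a * conj a + b * conj b = 1) :
    stabilizerMatrix a b ∈ specialUnitaryGroup (Fin 3) ℂ := by
  rw [mem_specialUnitaryGroup_iff]
  constructor
  · rw [mem_unitaryGroup_iff']
    ext i j
    fin_cases i <;> fin_cases j <;>
      simp [stabilizerMatrix, star_eq_conjTranspose, mul_apply, Fin.sum_univ_three] <;>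
      first | linear_combination h | ring
  · simp [stabilizerMatrix, det_fin_three]
    linear_combination h

lemma star_eq_adjugate_of_mem {n : Type*} [Fintype n] [DecidableEq n] {g : Matrix n n ℂ}
    (hg : g ∈ specialUnitaryGroup n ℂ) : star g = adjugate g := by
  obtain ⟨hu, hd⟩ := mem_specialUnitaryGroup_iff.1 hg
  rw [mem_unitaryGroup_iff] at hu
  calc star g = adjugate g * g * star g := by rw [adjugate_mul, hd, one_smul, one_mul]
    _ = adjugate g := by rw [mul_assoc, hu, mul_one]

lemma eq_stabilizerMatrix {g : Matrix (Fin 3) (Fin 3) ℂ}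
    (hg : g ∈ specialUnitaryGroup (Fin 3) ℂ) (h0 : g 0 0 = 1) (h1 : g 1 0 = 0)
    (h2 : g 2 0 = 0) : g = stabilizerMatrix (g 1 1) (g 2 1) := by
  have key := star_eq_adjugate_of_mem hg
  rw [adjugate_fin_three, star_eq_conjTranspose] at key
  have entry (i j : Fin 3) := congrArg conj (congrFun (congrFun key i) j)
  have e01 := entry 1 0
  have e02 := entry 2 0
  have e12 := entry 2 1
  have e22 := entry 2 2
  simp [h0, h1, h2] at e01 e02 e12 e22
  ext i j
  fin_cases i <;> fin_cases j <;> simp [stabilizerMatrix, *]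

lemma column_normSq {g : Matrix (Fin 3) (Fin 3) ℂ} (hg : g ∈ specialUnitaryGroup (Fin 3) ℂ)
    (j : Fin 3) :
    g 0 j * conj (g 0 j) + g 1 j * conj (g 1 j) + g 2 j * conj (g 2 j) = 1 := by
  have h := mem_unitaryGroup_iff'.1 (mem_specialUnitaryGroup_iff.1 hg).1
  simpa [star_eq_conjTranspose, mul_apply, Fin.sum_univ_three, mul_comm]
    using congrFun (congrFun h j) j

/-- The complex number `x + i y`. -/
def toComplex (x y : ℝ) : ℂ := ⟨x, y⟩

lemma toComplex_mul_conj (x y : ℝ) :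
    toComplex x y * conj (toComplex x y) = ((x ^ 2 + y ^ 2 : ℝ) : ℂ) := by
  rw [Complex.mul_conj]
  simp [toComplex, Complex.normSq_apply, sq]

@[fun_prop]
lemma continuous_toComplex {α : Type*} [TopologicalSpace α] {f g : α → ℝ} (hf : Continuous f)
    (hg : Continuous g) : Continuous fun a => toComplex (f a) (g a) :=
  Complex.equivRealProdCLM.symm.continuous.comp (hf.prodMk hg)

lemma sphere_three_sum (x : Metric.sphere (0 : EuclideanSpace ℝ (Fin 4)) 1) :
    toComplex (x.1 0) (x.1 1) * conj (toComplex (x.1 0) (x.1 1)) +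
      toComplex (x.1 2) (x.1 3) * conj (toComplex (x.1 2) (x.1 3)) = 1 := by
  have h := EuclideanSpace.real_norm_sq_eq x.1
  rw [norm_eq_of_mem_sphere, Fin.sum_univ_four] at h
  rw [toComplex_mul_conj, toComplex_mul_conj]
  norm_cast
  linarith

lemma sphere_four_sum (y : Metric.sphere (0 : EuclideanSpace ℝ (Fin 5)) 1) :
    ((y.1 0 : ℝ) : ℂ) ^ 2 + toComplex (y.1 1) (y.1 2) * conj (toComplex (y.1 1) (y.1 2)) +
      toComplex (y.1 3) (y.1 4) * conj (toComplex (y.1 3) (y.1 4)) = 1 := by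
  have h := EuclideanSpace.real_norm_sq_eq y.1
  rw [norm_eq_of_mem_sphere, Fin.sum_univ_five] at h
  rw [toComplex_mul_conj, toComplex_mul_conj]
  norm_cast
  linarith

/-- The section over `S⁴` of the bundle `SU(3) → S⁵` given by the first column. -/
noncomputable def frame (y : Metric.sphere (0 : EuclideanSpace ℝ (Fin 5)) 1) : SU3 :=
  ⟨frameMatrix (y.1 0) (toComplex (y.1 1) (y.1 2)) (toComplex (y.1 3) (y.1 4)),
    frameMatrix_mem (sphere_four_sum y)⟩

/-- The identification of `S³` with the stabilizer `SU(2)` of the first basis vector. -/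
def stabilizer (x : Metric.sphere (0 : EuclideanSpace ℝ (Fin 4)) 1) : SU3 :=
  ⟨stabilizerMatrix (toComplex (x.1 0) (x.1 1)) (toComplex (x.1 2) (x.1 3)),
    stabilizerMatrix_mem (sphere_three_sum x)⟩

lemma continuous_frame : Continuous frame := by
  refine Continuous.subtype_mk (continuous_matrix fun i j => ?_) _
  have hp (y : Metric.sphere (0 : EuclideanSpace ℝ (Fin 5)) 1) := ofReal_add_I_ne_zero (y.1 0)
  have hq (y : Metric.sphere (0 : EuclideanSpace ℝ (Fin 5)) 1) := ofReal_sub_I_ne_zero (y.1 0)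
  fin_cases i <;> fin_cases j <;> simp [frameMatrix] <;> fun_prop (disch := assumption)

lemma continuous_stabilizer : Continuous stabilizer := by
  refine Continuous.subtype_mk (continuous_matrix fun i j => ?_) _
  fin_cases i <;> fin_cases j <;> simp [stabilizerMatrix] <;> fun_prop

lemma frame_mul_stabilizer_col_zero (x : Metric.sphere (0 : EuclideanSpace ℝ (Fin 4)) 1)
    (y : Metric.sphere (0 : EuclideanSpace ℝ (Fin 5)) 1) (i : Fin 3) :
    (frame y * stabilizer x).1 i 0 = (frame y).1 i 0 := by
  simp [mul_apply, Fin.sum_univ_three, stabilizer, stabilizerMatrix]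

lemma frame_injective {y y' : Metric.sphere (0 : EuclideanSpace ℝ (Fin 5)) 1}
    (h : ∀ i, (frame y).1 i 0 = (frame y').1 i 0) : y = y' := by
  have h0 := h 0
  have h1 := h 1
  have h2 := h 2
  simp [frame, frameMatrix, toComplex] at h0 h1 h2
  ext i
  fin_cases i <;> simp [h0, h1, h2]

lemma stabilizer_injective : Function.Injective stabilizer := fun x x' h => by
  have h1 : (stabilizer x).1 1 1 = (stabilizer x').1 1 1 := by rw [h]
  have h2 : (stabilizer x).1 2 1 = (stabilizer x').1 2 1 := by rw [h]
  simp [stabilizer, stabilizerMatrix, toComplex] at h1 h2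
  ext i
  fin_cases i <;> simp [h1, h2]

lemma exists_stabilizer_eq {g : SU3} (h0 : g.1 0 0 = 1) (h1 : g.1 1 0 = 0) (h2 : g.1 2 0 = 0) :
    ∃ x, stabilizer x = g := by
  have hs := eq_stabilizerMatrix g.2 h0 h1 h2
  have h01 : g.1 0 1 = 0 := by rw [hs]; simp [stabilizerMatrix]
  have hn := column_normSq g.2 1
  simp only [h01, zero_mul, zero_add, Complex.mul_conj, Complex.normSq_apply] at hn
  norm_cast at hn
  refine ⟨⟨!₂[(g.1 1 1).re, (g.1 1 1).im, (g.1 2 1).re, (g.1 2 1).im], ?_⟩, Subtype.ext ?_⟩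
  · rw [mem_sphere_zero_iff_norm, ← sq_eq_sq₀ (norm_nonneg _) zero_le_one,
      EuclideanSpace.real_norm_sq_eq, Fin.sum_univ_four]
    simp
    linarith
  · exact hs.symm

lemma exists_frame_col_zero_eq {g : SU3} (hg : g ∈ X7) : ∃ y, ∀ i, (frame y).1 i 0 = g.1 i 0 := by
  have hn := column_normSq g.2 0
  have him : (g.1 0 0).im = 0 := hg
  simp only [Complex.mul_conj, Complex.normSq_apply, him, mul_zero, add_zero] at hn
  norm_cast at hn
  refine ⟨⟨!₂[(g.1 0 0).re, (g.1 1 0).re, (g.1 1 0).im, (g.1 2 0).re, (g.1 2 0).im], ?_⟩,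
    fun i => ?_⟩
  · rw [mem_sphere_zero_iff_norm, ← sq_eq_sq₀ (norm_nonneg _) zero_le_one,
      EuclideanSpace.real_norm_sq_eq, Fin.sum_univ_five]
    simp
    linarith
  · fin_cases i <;> simp [frame, frameMatrix, toComplex]
    exact Complex.ext rfl him.symm

/-- The trivialization of the bundle `X⁷ → S⁴` given by `frame`. -/
noncomputable def trivialization (p : Metric.sphere (0 : EuclideanSpace ℝ (Fin 4)) 1 ×
    Metric.sphere (0 : EuclideanSpace ℝ (Fin 5)) 1) : X7 :=
  ⟨frame p.2 * stabilizer p.1, by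
    change Complex.im _ = 0
    rw [frame_mul_stabilizer_col_zero]
    simp [frame, frameMatrix]⟩

lemma continuous_trivialization : Continuous trivialization :=
  ((continuous_frame.comp continuous_snd).mul
    (continuous_stabilizer.comp continuous_fst)).subtype_mk _

lemma trivialization_injective : Function.Injective trivialization := by
  rintro ⟨x, y⟩ ⟨x', y'⟩ h
  have h' : frame y * stabilizer x = frame y' * stabilizer x' := congrArg Subtype.val h
  obtain rfl : y = y' := frame_injective fun i => by
    rw [← frame_mul_stabilizer_col_zero x, h', frame_mul_stabilizer_col_zero]
  rw [stabilizer_injective (mul_left_cancel h')]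

lemma trivialization_surjective : Function.Surjective trivialization := by
  rintro ⟨g, hg⟩
  obtain ⟨y, hy⟩ := exists_frame_col_zero_eq hg
  have hcol (i : Fin 3) : ((frame y)⁻¹ * g).1 i 0 = (1 : Matrix (Fin 3) (Fin 3) ℂ) i 0 := by
    have h : ((frame y)⁻¹ * g).1 i 0 = ((frame y)⁻¹ * frame y).1 i 0 := by
      simp only [Submonoid.coe_mul, mul_apply, hy]
    rw [h, inv_mul_cancel]
    rfl
  obtain ⟨x, hx⟩ := exists_stabilizer_eq (hcol 0) (hcol 1) (hcol 2)
  exact ⟨(x, y), Subtype.ext (by simp [trivialization, hx])⟩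

/-- The subspace `X⁷` of `SU(3)` (with the topology induced from the space of
3×3 complex matrices) is homeomorphic to `S³ × S⁴`. -/
theorem X7_homeomorphic_sphere_prod :
    Nonempty (X7 ≃ₜ
      (Metric.sphere (0 : EuclideanSpace ℝ (Fin 4)) 1 ×
        Metric.sphere (0 : EuclideanSpace ℝ (Fin 5)) 1)) := by
  have h : IsHomeomorph trivialization := isHomeomorph_iff_continuous_bijective.2
    ⟨continuous_trivialization, trivialization_injective, trivialization_surjective⟩
  exact ⟨h.homeomorph.symm⟩
end

section
/- For all x, y ∈ X⁷, there exist g₁, g₂ ∈ SU(2)ₑ with y = g₁·x·g₂ if and only if y₁₁ = x₁₁. In other words, the orbits of the action of SU(2)ₑ × SU(2)ₑ on X⁷ by left and right multiplication are exactly the level sets of the (real-valued) function g ↦ g₁₁ on X⁷. -/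
open Matrix

open ComplexConjugate

/-- Two vectors of `ℂ²` of equal norm differ by an element of `SU(2)`, given here by its
entries `α`, `-conj β`, `β`, `conj α`. -/
lemma exists_specialUnitary_two_map (u₁ u₂ v₁ v₂ : ℂ)
    (h : u₁ * conj u₁ + u₂ * conj u₂ = v₁ * conj v₁ + v₂ * conj v₂) :
    ∃ α β : ℂ, α * conj α + β * conj β = 1 ∧
      α * u₁ - conj β * u₂ = v₁ ∧ β * u₁ + conj α * u₂ = v₂ := by
  have eq_zero : ∀ a b : ℂ, a * conj a + b * conj b = 0 → a = 0 ∧ b = 0 := by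
    intro a b hab
    simp only [Complex.mul_conj] at hab
    norm_cast at hab
    have ha := Complex.normSq_nonneg a
    have hb := Complex.normSq_nonneg b
    exact ⟨Complex.normSq_eq_zero.1 (by linarith), Complex.normSq_eq_zero.1 (by linarith)⟩
  by_cases hn : u₁ * conj u₁ + u₂ * conj u₂ = 0
  · obtain ⟨rfl, rfl⟩ := eq_zero _ _ hn
    obtain ⟨rfl, rfl⟩ := eq_zero _ _ (h ▸ hn)
    exact ⟨1, 0, by simp⟩
  · obtain ⟨n, hn_def⟩ : ∃ n, n = u₁ * conj u₁ + u₂ * conj u₂ := ⟨_, rfl⟩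
    have hn_conj : conj n = n := by
      rw [hn_def]
      simp only [map_add, map_mul, Complex.conj_conj]
      ring
    rw [← hn_def] at hn h
    refine ⟨(v₁ * conj u₁ + conj v₂ * u₂) / n, (v₂ * conj u₁ - conj v₁ * u₂) / n, ?_, ?_, ?_⟩ <;>
      simp only [map_add, map_sub, map_mul, map_div₀, Complex.conj_conj, hn_conj] <;>
      field_simp
    · linear_combination (-n) * h - (v₁ * conj v₁ + v₂ * conj v₂) * hn_def
    · linear_combination (-v₁) * hn_def
    · linear_combination (-v₂) * hn_def

/-- The element of `SU(3)` acting on the last two coordinates by the element of `SU(2)` with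
first column `(α, β)`. -/
def blockSU3 (α β : ℂ) (h : α * conj α + β * conj β = 1) : SU3 :=
  ⟨!![1, 0, 0; 0, α, -conj β; 0, β, conj α], by
    rw [mem_specialUnitaryGroup_iff, mem_unitaryGroup_iff]
    constructor
    · ext i j
      fin_cases i <;> fin_cases j <;>
        simp [Matrix.mul_apply, Fin.sum_univ_three, star_apply] <;>
        grind
    · simp [det_fin_three]
      linear_combination h⟩

lemma blockSU3_mem_SU2e (α β : ℂ) (h : α * conj α + β * conj β = 1) :
    blockSU3 α β h ∈ SU2e := by
  refine ⟨rfl, fun j hj => ?_⟩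
  fin_cases j <;> simp_all [blockSU3]

lemma inv_mul_apply_zero_of_col_eq {z y : SU3}
    (h : ∀ i, (y : Matrix (Fin 3) (Fin 3) ℂ) i 0 = (z : Matrix (Fin 3) (Fin 3) ℂ) i 0)
    (i : Fin 3) :
    ((z⁻¹ * y : SU3) : Matrix (Fin 3) (Fin 3) ℂ) i 0 =
      (1 : Matrix (Fin 3) (Fin 3) ℂ) i 0 := by
  have hz : ((z⁻¹ * z : SU3) : Matrix (Fin 3) (Fin 3) ℂ) = 1 := by simp
  rw [← hz]
  simp only [Submonoid.coe_mul, Matrix.mul_apply, h]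

/-- Elements of `SU(3)` with the same first column differ by right multiplication by an element
of the stabilizer of the first basis vector. -/
lemma inv_mul_mem_SU2e_of_col_eq {z y : SU3}
    (h : ∀ i, (y : Matrix (Fin 3) (Fin 3) ℂ) i 0 = (z : Matrix (Fin 3) (Fin 3) ℂ) i 0) :
    z⁻¹ * y ∈ SU2e := by
  refine ⟨by simpa using inv_mul_apply_zero_of_col_eq h 0, fun j hj => ⟨?_, ?_⟩⟩
  · have hinv : z⁻¹ * y = star (y⁻¹ * z) := by
      change z⁻¹ * y = (y⁻¹ * z)⁻¹
      group
    rw [hinv]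
    change star (((y⁻¹ * z : SU3) : Matrix (Fin 3) (Fin 3) ℂ) j 0) = 0
    rw [inv_mul_apply_zero_of_col_eq (fun i => (h i).symm), one_apply_ne hj, star_zero]
  · rw [inv_mul_apply_zero_of_col_eq h, one_apply_ne hj]

lemma sum_col_mul_conj (x : SU3) :
    ∑ i, (x : Matrix (Fin 3) (Fin 3) ℂ) i 0 * conj ((x : Matrix (Fin 3) (Fin 3) ℂ) i 0) = 1 := by
  have h := congr_fun₂ (mem_unitaryGroup_iff'.1 (mem_specialUnitaryGroup_iff.1 x.2).1) 0 0
  simpa [Matrix.mul_apply, star_apply, mul_comm] using h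

/-- For `x, y ∈ X⁷`, there exist `g₁, g₂ ∈ SU(2)ₑ` with `y = g₁·x·g₂` if and
only if `y₁₁ = x₁₁`: the orbits of the two-sided `SU(2)ₑ × SU(2)ₑ`-action on `X⁷` are exactly
the level sets of `g ↦ g₁₁`. -/
theorem two_sided_orbit_iff_entry (x y : SU3) (hx : x ∈ X7) (hy : y ∈ X7) :
    (∃ g₁ g₂ : SU3, g₁ ∈ SU2e ∧ g₂ ∈ SU2e ∧ y = g₁ * x * g₂) ↔
      (y : Matrix (Fin 3) (Fin 3) ℂ) 0 0 = (x : Matrix (Fin 3) (Fin 3) ℂ) 0 0 := by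
  constructor
  · rintro ⟨g₁, g₂, ⟨h₁, h₁'⟩, ⟨h₂, h₂'⟩, rfl⟩
    simp [Matrix.mul_apply, Fin.sum_univ_three, h₁, h₂, h₁' 1, h₁' 2, h₂' 1, h₂' 2]
  · intro h
    have hx_col := sum_col_mul_conj x
    have hy_col := sum_col_mul_conj y
    rw [Fin.sum_univ_three] at hx_col hy_col
    rw [h] at hy_col
    obtain ⟨α, β, hαβ, h₁, h₂⟩ := exists_specialUnitary_two_map
      ((x : Matrix (Fin 3) (Fin 3) ℂ) 1 0) ((x : Matrix (Fin 3) (Fin 3) ℂ) 2 0)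
      ((y : Matrix (Fin 3) (Fin 3) ℂ) 1 0) ((y : Matrix (Fin 3) (Fin 3) ℂ) 2 0)
      (by linear_combination hx_col - hy_col)
    refine ⟨blockSU3 α β hαβ, (blockSU3 α β hαβ * x)⁻¹ * y, blockSU3_mem_SU2e α β hαβ,
      inv_mul_mem_SU2e_of_col_eq fun i => ?_, by group⟩
    fin_cases i
    · simp [blockSU3, Matrix.mul_apply, Fin.sum_univ_three, h]
    · simp [blockSU3, Matrix.mul_apply, Fin.sum_univ_three, ← h₁, sub_eq_add_neg]
    · simp [blockSU3, Matrix.mul_apply, Fin.sum_univ_three, ← h₂]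
end
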